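/- arXiv:1405.7392 — 3 statements merged into one kernel-verified Lean document; each statement's English description precedes it below -/
import Mathlib

section
/- Let (Ω, F) be a measurable space, let p be a probability measure on it, let ρ < 0 be a real number, and let J : Ω → ℝ be a bounded measurable function. Then −(1/|ρ|)·log(∫ exp(−|ρ|·J(ω)) dp(ω)) equals the infimum, over all probability measures q on (Ω, F) that are absolutely continuous with respect to p and have finite relative entropy KL(q‖p), of the quantity ∫ J(ω) dq(ω) + (1/|ρ|)·KL(q‖p). -/
open MeasureTheory Real

/-- The easy half of the Donsker–Varadhan variational formula. -/
lemma integral_sub_integral_llr_le_log_integral_exp {Ω : Type*} [MeasurableSpace Ω]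
    {p q : Measure Ω} [IsProbabilityMeasure p] [IsProbabilityMeasure q] {f : Ω → ℝ}
    (hqp : q ≪ p) (h_int : Integrable (llr q p) q) (hfq : Integrable f q)
    (hfp : Integrable (fun ω => exp (f ω)) p) :
    ∫ ω, f ω ∂q - ∫ ω, llr q p ω ∂q ≤ log (∫ ω, exp (f ω) ∂p) := by
  have := isProbabilityMeasure_tilted hfp
  have h_nonneg := InformationTheory.integral_llr_add_sub_measure_univ_nonneg
    (hqp.trans (absolutelyContinuous_tilted hfp))
    (integrable_llr_tilted_right hqp hfq h_int hfp)
  rw [integral_llr_tilted_right hqp hfq hfp h_int] at h_nonneg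
  simp only [probReal_univ] at h_nonneg
  linarith

/-- The log-likelihood ratio of an exponentially tilted measure with respect to the base measure. -/
lemma llr_tilted_self_ae_eq {Ω : Type*} [MeasurableSpace Ω]
    {p : Measure Ω} [SigmaFinite p] {f : Ω → ℝ}
    (hfp : Integrable (fun ω => exp (f ω)) p) :
    llr (p.tilted f) p =ᵐ[p.tilted f] fun ω => f ω - log (∫ ω, exp (f ω) ∂p) :=
  (tilted_absolutelyContinuous p f).ae_le (log_rnDeriv_tilted_left_self hfp)

theorem neg_free_energy_eq_inf_total_cost
    {Ω : Type*} [MeasurableSpace Ω]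
    (p : Measure Ω) [IsProbabilityMeasure p]
    (ρ : ℝ) (hρ : ρ < 0) (J : Ω → ℝ) (hJ : Measurable J)
    (C : ℝ) (hbdd : ∀ ω, |J ω| ≤ C) :
    -(1 / |ρ|) * Real.log (∫ ω, Real.exp (-|ρ| * J ω) ∂p)
      = sInf { r : ℝ | ∃ q : Measure Ω, IsProbabilityMeasure q ∧ q ≪ p ∧
          Integrable (fun ω => Real.log ((q.rnDeriv p ω).toReal)) q ∧
          r = (∫ ω, J ω ∂q)
                + (1 / |ρ|) * ∫ ω, Real.log ((q.rnDeriv p ω).toReal) ∂q } := by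
  have hρ_pos : 0 < |ρ| := abs_pos.mpr hρ.ne
  have hJ_int (q : Measure Ω) [IsProbabilityMeasure q] : Integrable J q :=
    .of_bound hJ.aestronglyMeasurable C (ae_of_all _ hbdd)
  have h_exp : Integrable (fun ω => exp (-|ρ| * J ω)) p := by
    refine .of_bound (by fun_prop) (exp (|ρ| * C)) (ae_of_all _ fun ω => ?_)
    rw [norm_eq_abs, abs_exp, exp_le_exp]
    nlinarith [neg_le_of_abs_le (hbdd ω)]
  refine (IsLeast.csInf_eq ⟨?_, ?_⟩).symm
  · have hq := isProbabilityMeasure_tilted h_exp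
    have h_llr := llr_tilted_self_ae_eq h_exp
    have h_int := (hJ_int (p.tilted fun ω => -|ρ| * J ω)).const_mul (-|ρ|)
    refine ⟨p.tilted fun ω => -|ρ| * J ω, hq, tilted_absolutelyContinuous _ _,
      (integrable_congr h_llr).mpr (h_int.sub (integrable_const _)), ?_⟩
    have h_eq := integral_congr_ae h_llr
    rw [integral_sub h_int (integrable_const _), integral_const_mul, integral_const,
      probReal_univ, one_smul] at h_eq
    simp only [llr] at h_eq
    rw [h_eq]
    field_simp
    ring
  · rintro _ ⟨q, hq, hqp, h_int, rfl⟩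
    have h_le := integral_sub_integral_llr_le_log_integral_exp hqp h_int
      ((hJ_int q).const_mul (-|ρ|)) h_exp
    rw [integral_const_mul] at h_le
    simp only [llr, neg_mul] at h_le
    rw [← mul_le_mul_iff_right₀ hρ_pos]
    field_simp
    linarith
end

section
/- Let (Ω, F) be a measurable space, let p be a probability measure on it, let ρ be a real number, and let J : Ω → ℝ be a bounded measurable function. Then log(∫ exp(ρ·J(ω)) dp(ω)) equals the supremum, over all probability measures q on (Ω, F) that are absolutely continuous with respect to p and have finite relative entropy KL(q‖p), of the quantity ρ·∫ J(ω) dq(ω) − KL(q‖p). -/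
open MeasureTheory Real

/-- The relative entropy of the Gibbs measure `p.tilted f` with respect to `p`. -/
lemma integral_llr_tilted_self {Ω : Type*} [MeasurableSpace Ω]
    (p : Measure Ω) [IsProbabilityMeasure p] {f : Ω → ℝ}
    (hexp : Integrable (fun ω => exp (f ω)) p) (hf : Integrable f (p.tilted f)) :
    Integrable (llr (p.tilted f) p) (p.tilted f) ∧
      ∫ ω, llr (p.tilted f) p ω ∂(p.tilted f)
        = ∫ ω, f ω ∂(p.tilted f) - log (∫ ω, exp (f ω) ∂p) := by
  have : IsProbabilityMeasure (p.tilted f) := isProbabilityMeasure_tilted hexp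
  have h : llr (p.tilted f) p =ᵐ[p.tilted f] fun ω => f ω - log (∫ x, exp (f x) ∂p) :=
    (tilted_absolutelyContinuous p f).ae_le (log_rnDeriv_tilted_left_self hexp)
  refine ⟨(hf.sub (integrable_const _)).congr h.symm, ?_⟩
  rw [integral_congr_ae h, integral_sub hf (integrable_const _)]
  simp

/-- The Gibbs variational inequality. -/
lemma integral_sub_integral_llr_le {Ω : Type*} [MeasurableSpace Ω]
    (p q : Measure Ω) [IsProbabilityMeasure p] [IsProbabilityMeasure q] {f : Ω → ℝ}
    (hqp : q ≪ p) (hexp : Integrable (fun ω => exp (f ω)) p) (hf : Integrable f q)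
    (hllr : Integrable (llr q p) q) :
    ∫ ω, f ω ∂q - ∫ ω, llr q p ω ∂q ≤ log (∫ ω, exp (f ω) ∂p) := by
  have : IsProbabilityMeasure (p.tilted f) := isProbabilityMeasure_tilted hexp
  have h := InformationTheory.integral_llr_add_sub_measure_univ_nonneg
    (hqp.trans (absolutelyContinuous_tilted hexp))
    (integrable_llr_tilted_right hqp hf hllr hexp)
  rw [integral_llr_tilted_right hqp hf hexp hllr] at h
  simp only [probReal_univ] at h
  linarith

theorem free_energy_eq_sup_legendre
    {Ω : Type*} [MeasurableSpace Ω]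
    (p : Measure Ω) [IsProbabilityMeasure p]
    (ρ : ℝ) (J : Ω → ℝ) (hJ : Measurable J)
    (C : ℝ) (hbdd : ∀ ω, |J ω| ≤ C) :
    Real.log (∫ ω, Real.exp (ρ * J ω) ∂p)
      = sSup { r : ℝ | ∃ q : Measure Ω, IsProbabilityMeasure q ∧ q ≪ p ∧
          Integrable (fun ω => Real.log ((q.rnDeriv p ω).toReal)) q ∧
          r = ρ * (∫ ω, J ω ∂q)
                - ∫ ω, Real.log ((q.rnDeriv p ω).toReal) ∂q } := by
  have hint (q : Measure Ω) [IsProbabilityMeasure q] : Integrable (fun ω => ρ * J ω) q :=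
    (Integrable.of_bound hJ.aestronglyMeasurable C (.of_forall hbdd)).const_mul ρ
  have hexp : Integrable (fun ω => exp (ρ * J ω)) p := by
    refine Integrable.of_bound (by fun_prop) (exp (|ρ| * C)) (.of_forall fun ω => ?_)
    rw [norm_of_nonneg (exp_pos _).le, exp_le_exp]
    calc ρ * J ω ≤ |ρ| * |J ω| := (le_abs_self _).trans (abs_mul _ _).le
      _ ≤ |ρ| * C := by gcongr; exact hbdd ω
  have hgibbs : IsProbabilityMeasure (p.tilted fun ω => ρ * J ω) :=
    isProbabilityMeasure_tilted hexp
  obtain ⟨hllr, hval⟩ := integral_llr_tilted_self p hexp (hint _)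
  symm
  apply IsGreatest.csSup_eq
  refine ⟨⟨p.tilted fun ω => ρ * J ω, hgibbs, tilted_absolutelyContinuous _ _, hllr, ?_⟩, ?_⟩
  · simp only [llr_def, integral_const_mul] at hval
    rw [hval]
    ring
  · rintro _ ⟨q, hq, hqp, hq_llr, rfl⟩
    rw [← integral_const_mul]
    exact integral_sub_integral_llr_le p q hqp hexp (hint q) hq_llr
end

section
/- Let (Ω, F) be a measurable space, let p be a probability measure on it, let ρ < 0 be a real number, and let J : Ω → ℝ be a bounded measurable function. Let Z = ∫ exp(−|ρ|·J(ω)) dp(ω) and let q* be the probability measure with density dq*/dp = exp(−|ρ|·J)/Z with respect to p. If q is any probability measure absolutely continuous with respect to p, with log(dq/dp) integrable with respect to q, such that ∫ J dq + (1/|ρ|)·KL(q‖p) = −(1/|ρ|)·log Z, then q = q*; that is, the Gibbs measure is the unique minimizer of the total cost q ↦ E_q[J] + (1/|ρ|)·KL(q‖p). -/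
open MeasureTheory Real

/-- Equality case of the Donsker–Varadhan variational inequality. -/
lemma eq_tilted_of_integral_llr_eq {Ω : Type*} [MeasurableSpace Ω]
    {μ ν : Measure Ω} [IsProbabilityMeasure μ] [IsProbabilityMeasure ν] {f : Ω → ℝ}
    (hμν : μ ≪ ν) (hfμ : Integrable f μ) (hfν : Integrable (fun x ↦ exp (f x)) ν)
    (h_int : Integrable (llr μ ν) μ)
    (h : ∫ x, llr μ ν x ∂μ = ∫ x, f x ∂μ - log (∫ x, exp (f x) ∂ν)) :
    μ = ν.tilted f := by
  have : IsProbabilityMeasure (ν.tilted f) := isProbabilityMeasure_tilted hfν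
  have hac : μ ≪ ν.tilted f := hμν.trans (absolutelyContinuous_tilted hfν)
  have h_llr := integral_llr_tilted_right hμν hfμ hfν h_int
  rw [← InformationTheory.klDiv_eq_zero_iff, InformationTheory.klDiv_of_ac_of_integrable hac
    (integrable_llr_tilted_right hμν hfμ h_int hfν), h_llr, h]
  simp

theorem gibbs_measure_unique_minimizer
    {Ω : Type*} [MeasurableSpace Ω]
    (p : Measure Ω) [IsProbabilityMeasure p]
    (ρ : ℝ) (hρ : ρ < 0) (J : Ω → ℝ) (hJ : Measurable J)
    (C : ℝ) (hbdd : ∀ ω, |J ω| ≤ C)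
    (Z : ℝ) (hZ : Z = ∫ ω, Real.exp (-|ρ| * J ω) ∂p)
    (qstar : Measure Ω)
    (hqstar : qstar = p.withDensity
        (fun ω => ENNReal.ofReal (Real.exp (-|ρ| * J ω) / Z)))
    (q : Measure Ω) [IsProbabilityMeasure q] (hac : q ≪ p)
    (hlog : Integrable (fun ω => Real.log ((q.rnDeriv p ω).toReal)) q)
    (heq : (∫ ω, J ω ∂q)
        + (1 / |ρ|) * (∫ ω, Real.log ((q.rnDeriv p ω).toReal) ∂q)
      = -(1 / |ρ|) * Real.log Z) :
    q = qstar := by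
  subst hqstar hZ
  have hρ' : 0 < |ρ| := abs_pos.2 hρ.ne
  have hJq : Integrable J q := .of_bound hJ.aestronglyMeasurable C (.of_forall hbdd)
  have hexp : Integrable (fun ω ↦ exp (-|ρ| * J ω)) p := by
    refine .of_bound (by fun_prop) (exp (|ρ| * C)) (.of_forall fun ω ↦ ?_)
    rw [norm_of_nonneg (exp_pos _).le, exp_le_exp, neg_mul, ← mul_neg]
    exact mul_le_mul_of_nonneg_left (neg_le.1 (abs_le.1 (hbdd ω)).1) hρ'.le
  refine eq_tilted_of_integral_llr_eq hac (hJq.const_mul _) hexp hlog ?_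
  rw [integral_const_mul]
  simp only [llr_def, neg_mul] at heq ⊢
  field_simp at heq
  linarith
end
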